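/- arXiv:2001.05652 — 8 statements merged into one kernel-verified Lean document; each statement's English description precedes it below -/
import Mathlib

section
/- For n = 3 there is no mechanism producing stable fractional matchings under which truthful reporting is a Nash equilibrium at every instance. Precisely: there is no function f assigning to every matching instance of size 3 with strict preferences a fractional matching that is stable for that instance, such that for every instance (U,V) with strict preferences, for every man m and every alternative valuation row U'_m for which the deviated instance (U[m := U'_m], V) still has strict preferences, the true utility of m under f applied to the deviated instance, namely ∑_w (f(U[m := U'_m], V)) m w · U m w, is at most ∑_w (f(U,V)) m w · U m w, and symmetrically for every woman and every alternative valuation column for her. -/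
open Finset

/-- Nonnegativity of valuations: part of the definition of a matching instance. -/
def Nonneg {n : ℕ} (U V : Fin n → Fin n → ℝ) : Prop :=
  ∀ m w, 0 ≤ U m w ∧ 0 ≤ V m w

/-- Strict preferences: each agent's valuations over the other side are injective. -/
def StrictPrefs {n : ℕ} (U V : Fin n → Fin n → ℝ) : Prop :=
  (∀ m, Function.Injective fun w => U m w) ∧ (∀ w, Function.Injective fun m => V m w)

/-- A fractional matching. -/
def IsFracMatching {n : ℕ} (μ : Fin n → Fin n → ℝ) : Prop :=
  (∀ m w, 0 ≤ μ m w) ∧ (∀ m, ∑ w, μ m w ≤ 1) ∧ (∀ w, ∑ m, μ m w ≤ 1)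

/-- Utility of man `m` under fractional matching `μ`. -/
def manUtil {n : ℕ} (U μ : Fin n → Fin n → ℝ) (m : Fin n) : ℝ :=
  ∑ w, μ m w * U m w

/-- Utility of woman `w` under fractional matching `μ`. -/
def womanUtil {n : ℕ} (V μ : Fin n → Fin n → ℝ) (w : Fin n) : ℝ :=
  ∑ m, μ m w * V m w

/-- `(m, w)` blocks `μ`. -/
def Blocks {n : ℕ} (U V μ : Fin n → Fin n → ℝ) (m w : Fin n) : Prop :=
  U m w > manUtil U μ m ∧ V m w > womanUtil V μ w

/-- Stability of a fractional matching. -/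
def IsStable {n : ℕ} (U V μ : Fin n → Fin n → ℝ) : Prop :=
  ¬ ∃ m w, Blocks U V μ m w

/-- Integral matchings: all weights are 0 or 1. -/
def Integral {n : ℕ} (μ : Fin n → Fin n → ℝ) : Prop :=
  ∀ m w, μ m w = 0 ∨ μ m w = 1

/-- `(m, w)` is a mutual-first-preference pair. -/
def MFP {n : ℕ} (U V : Fin n → Fin n → ℝ) (m w : Fin n) : Prop :=
  (∀ w', w' ≠ w → U m w > U m w') ∧ (∀ m', m' ≠ m → V m w > V m' w)

/-- The conditioned mutual first preference (CMFP) property. -/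
def CMFP {n : ℕ} (U V : Fin n → Fin n → ℝ) : Prop :=
  ∃ mseq wseq : Equiv.Perm (Fin n),
    ∀ t s : Fin n, t < s →
      U (mseq t) (wseq t) > U (mseq t) (wseq s) ∧
      V (mseq t) (wseq t) > V (mseq s) (wseq t)

/-- Any stable fractional matching gives `w₀` a share above `3/4` of `m₀` once `w₀` reports the
values `20, 19, 0`, although the truthful instance also admits a stable matching pairing `w₀`
with `m₂`. -/
lemma three_quarters_lt_of_woman_deviation {μ : Fin 3 → Fin 3 → ℝ} (hμ : IsFracMatching μ)
    (hs : IsStable ![![1, 2, 0], ![2, 1, 0], ![2, 1, 0]]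
      ![![20, 1, 2], ![19, 0, 1], ![0, 2, 0]] μ) :
    3 / 4 < μ 0 0 := by
  obtain ⟨h0, hr, hc⟩ := hμ
  have h10 := not_and_or.mp fun h => hs ⟨1, 0, h⟩
  have h21 := not_and_or.mp fun h => hs ⟨2, 1, h⟩
  have h00 := not_and_or.mp fun h => hs ⟨0, 0, h⟩
  simp only [Fin.forall_fin_succ, Fin.sum_univ_three, manUtil, womanUtil] at *
  simp at *
  have h20 : μ 2 0 ≤ 1 / 20 := by rcases h10 with h | h <;> linarith
  have h21' : 9 / 10 ≤ μ 2 1 := by rcases h21 with h | h <;> linarith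
  rcases h00 with h | h <;> linarith

/-- Any stable fractional matching gives `m₀` a share above `3/4` of `w₁` once `m₀` reports the
values `0, 20, 19`, although the truthful instance also admits a stable matching pairing `m₀`
with `w₀`. -/
lemma three_quarters_lt_of_man_deviation {μ : Fin 3 → Fin 3 → ℝ} (hμ : IsFracMatching μ)
    (hs : IsStable ![![0, 20, 19], ![2, 1, 0], ![2, 1, 0]]
      ![![2, 1, 2], ![0, 0, 1], ![1, 2, 0]] μ) :
    3 / 4 < μ 0 1 := by
  obtain ⟨h0, hr, hc⟩ := hμ
  have h02 := not_and_or.mp fun h => hs ⟨0, 2, h⟩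
  have h20 := not_and_or.mp fun h => hs ⟨2, 0, h⟩
  have h01 := not_and_or.mp fun h => hs ⟨0, 1, h⟩
  simp only [Fin.forall_fin_succ, Fin.sum_univ_three, manUtil, womanUtil] at *
  simp at *
  have h00 : μ 0 0 ≤ 1 / 20 := by rcases h02 with h | h <;> linarith
  have h20' : 9 / 10 ≤ μ 2 0 := by rcases h20 with h | h <;> linarith
  rcases h01 with h | h <;> linarith

/-- For n = 3, there is no mechanism producing stable fractional
matchings under which truthful reporting is a Nash equilibrium at every
instance with strict preferences. -/
theorem no_incentive_compatible_mechanism :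
    ¬ ∃ f : (Fin 3 → Fin 3 → ℝ) → (Fin 3 → Fin 3 → ℝ) → (Fin 3 → Fin 3 → ℝ),
      (∀ U V : Fin 3 → Fin 3 → ℝ, Nonneg U V → StrictPrefs U V →
        IsFracMatching (f U V) ∧ IsStable U V (f U V)) ∧
      (∀ U V : Fin 3 → Fin 3 → ℝ, Nonneg U V → StrictPrefs U V →
        (∀ (m : Fin 3) (U'm : Fin 3 → ℝ),
          Nonneg (Function.update U m U'm) V →
          StrictPrefs (Function.update U m U'm) V →
          ∑ w, f (Function.update U m U'm) V m w * U m w ≤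
            ∑ w, f U V m w * U m w) ∧
        (∀ (w : Fin 3) (V'w : Fin 3 → ℝ),
          Nonneg U (fun m' w' => if w' = w then V'w m' else V m' w') →
          StrictPrefs U (fun m' w' => if w' = w then V'w m' else V m' w') →
          ∑ m, f U (fun m' w' => if w' = w then V'w m' else V m' w') m w * V m w ≤
            ∑ m, f U V m w * V m w)) := by
  rintro ⟨f, hf, hIC⟩
  set U : Fin 3 → Fin 3 → ℝ := ![![1, 2, 0], ![2, 1, 0], ![2, 1, 0]] with hU
  set V : Fin 3 → Fin 3 → ℝ := ![![2, 1, 2], ![0, 0, 1], ![1, 2, 0]] with hV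
  set U' : Fin 3 → Fin 3 → ℝ := ![![0, 20, 19], ![2, 1, 0], ![2, 1, 0]] with hU'
  set V' : Fin 3 → Fin 3 → ℝ := ![![20, 1, 2], ![19, 0, 1], ![0, 2, 0]] with hV'
  have nonneg : Nonneg U V ∧ Nonneg U' V ∧ Nonneg U V' := by
    refine ⟨?_, ?_, ?_⟩ <;> intro m w <;> fin_cases m <;> fin_cases w <;>
      norm_num [hU, hV, hU', hV']
  have strict : StrictPrefs U V ∧ StrictPrefs U' V ∧ StrictPrefs U V' := by
    refine ⟨⟨?_, ?_⟩, ⟨?_, ?_⟩, ⟨?_, ?_⟩⟩ <;> intro i a b <;>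
      fin_cases i <;> fin_cases a <;> fin_cases b <;> norm_num [hU, hV, hU', hV']
  obtain ⟨hn, hnU, hnV⟩ := nonneg
  obtain ⟨hs, hsU, hsV⟩ := strict
  have updU : Function.update U 0 ![0, 20, 19] = U' := by
    ext m w
    fin_cases m <;> simp [hU, hU']
  have updV : (fun m' w' => if w' = 0 then (![20, 19, 0] : Fin 3 → ℝ) m' else V m' w') = V' := by
    ext m w
    fin_cases m <;> fin_cases w <;> simp [hV, hV']
  have hman := (hIC U V hn hs).1 0 ![0, 20, 19]
  have hwoman := (hIC U V hn hs).2 0 ![20, 19, 0]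
  rw [updU] at hman
  rw [updV] at hwoman
  have hman := hman hnU hsU
  have hwoman := hwoman hnV hsV
  obtain ⟨⟨h0, hr, hc⟩, -⟩ := hf U V hn hs
  have hfU := hf U' V hnU hsU
  have hfV := hf U V' hnV hsV
  have gainU := three_quarters_lt_of_man_deviation hfU.1 hfU.2
  have gainV := three_quarters_lt_of_woman_deviation hfV.1 hfV.2
  have posU := hfU.1.1 0 0
  have posV := hfV.1.1 2 0
  have hr0 := hr 0
  have hc0 := hc 0
  have h02 := h0 0 2
  have h10 := h0 1 0
  have eU : U 0 0 = 1 ∧ U 0 1 = 2 ∧ U 0 2 = 0 := by simp [hU]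
  have eV : V 0 0 = 2 ∧ V 1 0 = 0 ∧ V 2 0 = 1 := by simp [hV]
  simp only [Fin.sum_univ_three, eU, eV] at hman hwoman hr0 hc0
  linarith
end

section
/- Let I = (U,V) be a CMFP matching instance of size n with strict preferences, and let μ* be its unique stable fractional matching. Then no single agent can gain by misreporting, under any mechanism producing stable fractional matchings: for every man m, every alternative valuation row U'_m such that the deviated instance (U[m := U'_m], V) has strict preferences, and every fractional matching μ' that is stable for the deviated instance, the true utility ∑_w μ' m w · U m w is at most ∑_w μ* m w · U m w; and symmetrically, for every woman w, every alternative valuation column for w making the deviated instance strict, and every stable fractional matching μ' of the deviated instance, ∑_m μ' m w · V m w ≤ ∑_m μ* m w · V m w. -/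
open Finset

section WeightedSums

variable {n : ℕ} {p a : Fin n → ℝ} {t : Fin n}

lemma sum_mul_le_of_support_le (hp : ∀ s, 0 ≤ p s) (hp1 : ∑ s, p s ≤ 1) (ha : 0 ≤ a t)
    (hzero : ∀ s < t, p s = 0) (hmax : ∀ s, t < s → a s < a t) :
    ∑ s, p s * a s ≤ a t := by
  calc ∑ s, p s * a s ≤ ∑ s, p s * a t := by
        refine Finset.sum_le_sum fun s _ => ?_
        rcases lt_trichotomy s t with h | h | h
        · simp [hzero s h]
        · rw [h]
        · exact mul_le_mul_of_nonneg_left (hmax s h).le (hp s)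
    _ = (∑ s, p s) * a t := (Finset.sum_mul ..).symm
    _ ≤ a t := mul_le_of_le_one_left ha hp1

lemma eq_one_of_le_sum_mul (hp : ∀ s, 0 ≤ p s) (hp1 : ∑ s, p s ≤ 1) (ha : 0 < a t)
    (hzero : ∀ s < t, p s = 0) (hmax : ∀ s, t < s → a s < a t)
    (hle : a t ≤ ∑ s, p s * a s) : p t = 1 := by
  have hnn : ∀ s ∈ (Finset.univ : Finset (Fin n)), 0 ≤ p s * (a t - a s) := by
    intro s _
    rcases lt_trichotomy s t with h | h | h
    · simp [hzero s h]
    · simp [h]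
    · exact mul_nonneg (hp s) (sub_nonneg.2 (hmax s h).le)
  have hsum : ∑ s, p s * (a t - a s) = (∑ s, p s) * a t - ∑ s, p s * a s := by
    simp only [mul_sub, Finset.sum_sub_distrib, Finset.sum_mul]
  have hsum0 : ∑ s, p s * (a t - a s) = 0 :=
    le_antisymm (by nlinarith) (Finset.sum_nonneg hnn)
  have hoff : ∀ s, s ≠ t → p s = 0 := by
    intro s hs
    rcases lt_or_gt_of_ne hs with h | h
    · exact hzero s h
    · have := (Finset.sum_eq_zero_iff_of_nonneg hnn).1 hsum0 s (Finset.mem_univ s)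
      exact (mul_eq_zero.1 this).resolve_right (sub_pos.2 (hmax s h)).ne'
  have hpt : ∑ s, p s = p t := Fintype.sum_eq_single t hoff
  have hat : ∑ s, p s * a s = p t * a t :=
    Fintype.sum_eq_single t fun s hs => by simp [hoff s hs]
  rw [hpt] at hp1
  rw [hat] at hle
  nlinarith

lemma eq_zero_of_eq_one (hp : ∀ s, 0 ≤ p s) (hp1 : ∑ s, p s ≤ 1) (ht : p t = 1)
    {s : Fin n} (hs : s ≠ t) : p s = 0 := by
  have h := Finset.add_le_sum (f := p) (fun i _ => hp i) (Finset.mem_univ s)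
    (Finset.mem_univ t) hs
  have := hp s
  linarith

end WeightedSums

/-- If rows and columns are ordered so that each diagonal pair is a mutual first preference among
the later ones, and no diagonal pair before `k` blocks, then all of these pairs are fully matched,
so neither member of pair `k` gets more than its diagonal value. -/
lemma util_le_diagonal {n : ℕ} {A B P : Fin n → Fin n → ℝ} {k : Fin n}
    (hnn : Nonneg A B) (hP : IsFracMatching P)
    (hdiag : ∀ t s, t < s → A t s < A t t ∧ B s t < B t t)
    (hstable : ∀ t < k, A t t ≤ manUtil A P t ∨ B t t ≤ womanUtil B P t) :
    manUtil A P k ≤ A k k ∧ womanUtil B P k ≤ B k k := by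
  obtain ⟨hpos, hrow, hcol⟩ := hP
  have hone : ∀ t, t < k → P t t = 1 := by
    intro t
    induction t using WellFoundedLT.induction with
    | ind t ih =>
      intro htk
      have hprev : ∀ s < t, P s s = 1 := fun s hs => ih s hs (hs.trans htk)
      rcases hstable t htk with h | h
      · exact eq_one_of_le_sum_mul (p := P t) (a := A t) (hpos t) (hrow t)
          ((hnn t k).1.trans_lt (hdiag t k htk).1)
          (fun s hs => eq_zero_of_eq_one (p := fun m => P m s) (fun m => hpos m s) (hcol s)
            (hprev s hs) hs.ne')
          (fun s hs => (hdiag t s hs).1) h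
      · exact eq_one_of_le_sum_mul (p := fun m => P m t) (a := fun m => B m t)
          (fun m => hpos m t) (hcol t)
          ((hnn k t).2.trans_lt (hdiag t k htk).2)
          (fun s hs => eq_zero_of_eq_one (hpos s) (hrow s) (hprev s hs) hs.ne')
          (fun s hs => (hdiag t s hs).2) h
  constructor
  · exact sum_mul_le_of_support_le (hpos k) (hrow k) (hnn k k).1
      (fun s hs => eq_zero_of_eq_one (p := fun m => P m s) (fun m => hpos m s) (hcol s)
        (hone s hs) hs.ne')
      (fun s hs => (hdiag k s hs).1)
  · exact sum_mul_le_of_support_le (p := fun m => P m k) (a := fun m => B m k)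
      (fun m => hpos m k) (hcol k) (hnn k k).2
      (fun s hs => eq_zero_of_eq_one (hpos s) (hrow s) (hone s hs) hs.ne')
      (fun s hs => (hdiag k s hs).2)

/-- The version of `util_le_diagonal` for arbitrary enumerations `σ`, `τ` of the two sides. -/
lemma util_le_of_cmfp_order {n : ℕ} {U V μ : Fin n → Fin n → ℝ} {σ τ : Equiv.Perm (Fin n)}
    {k : Fin n} (hnn : Nonneg U V) (hμ : IsFracMatching μ)
    (hord : ∀ t s, t < s → U (σ t) (τ s) < U (σ t) (τ t) ∧ V (σ s) (τ t) < V (σ t) (τ t))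
    (hstable : ∀ t < k, U (σ t) (τ t) ≤ manUtil U μ (σ t) ∨
      V (σ t) (τ t) ≤ womanUtil V μ (τ t)) :
    manUtil U μ (σ k) ≤ U (σ k) (τ k) ∧ womanUtil V μ (τ k) ≤ V (σ k) (τ k) := by
  have hman : ∀ t, manUtil (fun i j => U (σ i) (τ j)) (fun i j => μ (σ i) (τ j)) t =
      manUtil U μ (σ t) := fun t => Equiv.sum_comp τ fun w => μ (σ t) w * U (σ t) w
  have hwoman : ∀ t, womanUtil (fun i j => V (σ i) (τ j)) (fun i j => μ (σ i) (τ j)) t =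
      womanUtil V μ (τ t) := fun t => Equiv.sum_comp σ fun m => μ m (τ t) * V m (τ t)
  rw [← hman, ← hwoman]
  refine util_le_diagonal (A := fun i j => U (σ i) (τ j)) (B := fun i j => V (σ i) (τ j))
    (fun i j => hnn _ _) ⟨fun i j => hμ.1 _ _, fun i => ?_, fun j => ?_⟩ hord fun t ht => ?_
  · exact (Equiv.sum_comp τ fun w => μ (σ i) w).trans_le (hμ.2.1 _)
  · exact (Equiv.sum_comp σ fun m => μ m (τ j)).trans_le (hμ.2.2 _)
  · rw [hman, hwoman]
    exact hstable t ht

/-- The integral matching that pairs `σ t` with `τ t` for every `t`. -/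
def permMatching {n : ℕ} (σ τ : Equiv.Perm (Fin n)) (m w : Fin n) : ℝ :=
  if σ.symm m = τ.symm w then 1 else 0

section PermMatching

variable {n : ℕ} (σ τ : Equiv.Perm (Fin n))

lemma sum_permMatching_mul_right (t : Fin n) (f : Fin n → ℝ) :
    ∑ w, permMatching σ τ (σ t) w * f w = f (τ t) := by
  rw [← Equiv.sum_comp τ]
  simp [permMatching]

lemma sum_permMatching_mul_left (t : Fin n) (f : Fin n → ℝ) :
    ∑ m, permMatching σ τ m (τ t) * f m = f (σ t) := by
  rw [← Equiv.sum_comp σ]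
  simp [permMatching]

lemma isFracMatching_permMatching : IsFracMatching (permMatching σ τ) := by
  refine ⟨fun m w => ?_, fun m => ?_, fun w => ?_⟩
  · unfold permMatching
    split_ifs <;> norm_num
  · obtain ⟨t, rfl⟩ := σ.surjective m
    simpa using (sum_permMatching_mul_right σ τ t fun _ => 1).le
  · obtain ⟨t, rfl⟩ := τ.surjective w
    simpa using (sum_permMatching_mul_left σ τ t fun _ => 1).le

variable {σ τ} in
lemma isStable_permMatching {U V : Fin n → Fin n → ℝ}
    (hord : ∀ t s, t < s → U (σ t) (τ s) < U (σ t) (τ t) ∧ V (σ s) (τ t) < V (σ t) (τ t)) :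
    IsStable U V (permMatching σ τ) := by
  rintro ⟨m, w, hm, hw⟩
  obtain ⟨s, rfl⟩ := σ.surjective m
  obtain ⟨r, rfl⟩ := τ.surjective w
  rw [manUtil, sum_permMatching_mul_right] at hm
  rw [womanUtil, sum_permMatching_mul_left σ τ r fun m => V m (τ r)] at hw
  rcases lt_trichotomy s r with h | h | h
  · exact hm.not_gt (hord s r h).1
  · exact hm.ne (by rw [h])
  · exact hw.not_gt (hord r s h).2

end PermMatching

/-- On a CMFP instance with unique stable fractional matching `μ*`,
no single agent can gain by misreporting, under any mechanism producing
stable fractional matchings. -/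
theorem cmfp_incentive_compatible {n : ℕ} (U V : Fin n → Fin n → ℝ)
    (hnn : Nonneg U V) (hsp : StrictPrefs U V) (hcmfp : CMFP U V)
    (μstar : Fin n → Fin n → ℝ)
    (hμstar : IsFracMatching μstar ∧ IsStable U V μstar)
    (huniq : ∀ μ : Fin n → Fin n → ℝ, IsFracMatching μ → IsStable U V μ → μ = μstar) :
    (∀ (m : Fin n) (U'm : Fin n → ℝ),
      Nonneg (Function.update U m U'm) V →
      StrictPrefs (Function.update U m U'm) V →
      ∀ μ' : Fin n → Fin n → ℝ, IsFracMatching μ' →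
        IsStable (Function.update U m U'm) V μ' →
        ∑ w, μ' m w * U m w ≤ ∑ w, μstar m w * U m w) ∧
    (∀ (w : Fin n) (V'w : Fin n → ℝ),
      Nonneg U (fun m' w' => if w' = w then V'w m' else V m' w') →
      StrictPrefs U (fun m' w' => if w' = w then V'w m' else V m' w') →
      ∀ μ' : Fin n → Fin n → ℝ, IsFracMatching μ' →
        IsStable U (fun m' w' => if w' = w then V'w m' else V m' w') μ' →
        ∑ m, μ' m w * V m w ≤ ∑ m, μstar m w * V m w) := by
  obtain ⟨σ, τ, hord⟩ := hcmfp
  obtain rfl := huniq _ (isFracMatching_permMatching σ τ) (isStable_permMatching hord)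
  refine ⟨fun m U'm _ _ μ' hμ' hst => ?_, fun w V'w _ _ μ' hμ' hst => ?_⟩
  · obtain ⟨k, rfl⟩ := σ.surjective m
    rw [sum_permMatching_mul_right]
    refine (util_le_of_cmfp_order hnn hμ' hord fun t ht => ?_).1
    have hne : σ t ≠ σ k := σ.injective.ne ht.ne
    by_contra! h
    refine hst ⟨σ t, τ t, ?_, h.2⟩
    simpa [manUtil, Function.update_of_ne hne] using h.1
  · obtain ⟨k, rfl⟩ := τ.surjective w
    rw [sum_permMatching_mul_left σ τ k fun m => V m (τ k)]
    refine (util_le_of_cmfp_order hnn hμ' hord fun t ht => ?_).2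
    have hne : τ t ≠ τ k := τ.injective.ne ht.ne
    by_contra! h
    refine hst ⟨σ t, τ t, h.1, ?_⟩
    simpa only [womanUtil, if_neg hne] using h.2
end

section
/- Let I = (U,V) be a CMFP matching instance of size n with strict preferences, and let μ* be its unique stable fractional matching. Then no coalition can collude to make all of its members strictly better off: for every nonempty set S of agents (men and/or women), every joint misreport in which exactly the agents of S change their valuations (man m ∈ S changes his row of U, woman w ∈ S changes her column of V) such that the deviated instance has strict preferences, and every fractional matching μ' that is stable for the deviated instance, there exists a member of S whose true utility under μ' is not strictly greater than his/her true utility under μ*. -/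
open Finset

lemma sum_mul_le_of_subprob {ι : Type*} [Fintype ι] {p a : ι → ℝ} {c : ℝ} (hp : ∀ j, 0 ≤ p j)
    (hsum : ∑ j, p j ≤ 1) (hc : 0 ≤ c) (h : ∀ j, p j = 0 ∨ a j ≤ c) :
    ∑ j, p j * a j ≤ c := by
  calc ∑ j, p j * a j ≤ ∑ j, p j * c := by
        refine Finset.sum_le_sum fun j _ => ?_
        rcases h j with h0 | hj
        · simp [h0]
        · exact mul_le_mul_of_nonneg_left hj (hp j)
    _ = (∑ j, p j) * c := by rw [Finset.sum_mul]
    _ ≤ c := mul_le_of_le_one_left hc hsum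

/-- A subprobability vector whose average attains a positive strict maximum is concentrated there. -/
lemma eq_one_of_le_sum_mul_s5 {ι : Type*} [Fintype ι] {p a : ι → ℝ} {t : ι} (hp : ∀ j, 0 ≤ p j)
    (hsum : ∑ j, p j ≤ 1) (ht : 0 < a t) (h : ∀ j, j ≠ t → p j = 0 ∨ a j < a t)
    (hle : a t ≤ ∑ j, p j * a j) : p t = 1 := by
  have hterm : ∀ j ∈ univ, 0 ≤ p j * (a t - a j) := by
    intro j _
    rcases eq_or_ne j t with rfl | hj
    · simp
    · rcases h j hj with h0 | hlt
      · simp [h0]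
      · exact mul_nonneg (hp j) (sub_nonneg.2 hlt.le)
  have hsplit : ∑ j, p j * (a t - a j) = (∑ j, p j) * a t - ∑ j, p j * a j := by
    simp only [mul_sub, Finset.sum_sub_distrib, Finset.sum_mul]
  have hmass : (∑ j, p j) * a t ≤ a t := mul_le_of_le_one_left ht.le hsum
  have hzero : ∑ j, p j * (a t - a j) = 0 :=
    le_antisymm (by linarith) (Finset.sum_nonneg hterm)
  have hone : ∑ j, p j = 1 := by
    refine le_antisymm hsum ?_
    by_contra! hlt
    nlinarith
  have hsupp : ∀ j ∈ univ, j ≠ t → p j = 0 := by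
    intro j hj hjt
    have := (Finset.sum_eq_zero_iff_of_nonneg hterm).1 hzero j hj
    rcases h j hjt with h0 | hlt
    · exact h0
    · exact (mul_eq_zero.1 this).resolve_right (sub_pos.2 hlt).ne'
  rwa [Finset.sum_eq_single t hsupp (by simp)] at hone

lemma eq_zero_of_eq_one_s5 {ι : Type*} [Fintype ι] {p : ι → ℝ} {t s : ι} (hp : ∀ j, 0 ≤ p j)
    (hsum : ∑ j, p j ≤ 1) (ht : p t = 1) (hst : s ≠ t) : p s = 0 := by
  classical
  have := Finset.sum_le_sum_of_subset_of_nonneg (Finset.subset_univ {s, t}) fun j _ _ => hp j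
  rw [Finset.sum_pair hst] at this
  linarith [hp s]

/-- If along the diagonal order every diagonal pair is unblocked as soon as neither of its members
improves on the diagonal matching, then nobody improves on the diagonal matching. -/
lemma diagonal_unimprovable {n : ℕ} {A B M : Fin n → Fin n → ℝ} (hnn : Nonneg A B)
    (hdiag : ∀ t s, t < s → A t t > A t s ∧ B t t > B s t) (hM : IsFracMatching M)
    (hunblocked : ∀ t, manUtil A M t ≤ A t t → womanUtil B M t ≤ B t t →
      A t t ≤ manUtil A M t ∨ B t t ≤ womanUtil B M t) (t : Fin n) :
    manUtil A M t ≤ A t t ∧ womanUtil B M t ≤ B t t := by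
  obtain ⟨hpos, hrow, hcol⟩ := hM
  have key : ∀ t : Fin n, (manUtil A M t ≤ A t t ∧ womanUtil B M t ≤ B t t) ∧
      ∀ s, t < s → M t s = 0 ∧ M s t = 0 := by
    intro t
    induction t using WellFoundedLT.induction with
    | ind t ih =>
      have hA : ∀ j, j ≠ t → M t j = 0 ∨ A t j < A t t := fun j hj =>
        hj.lt_or_gt.imp (fun h => ((ih j h).2 t h).2) fun h => (hdiag t j h).1
      have hB : ∀ j, j ≠ t → M j t = 0 ∨ B j t < B t t := fun j hj =>
        hj.lt_or_gt.imp (fun h => ((ih j h).2 t h).1) fun h => (hdiag t j h).2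
      have hman : manUtil A M t ≤ A t t := by
        refine sum_mul_le_of_subprob (hpos t) (hrow t) (hnn t t).1 fun j => ?_
        rcases eq_or_ne j t with rfl | hj
        · exact Or.inr le_rfl
        · exact (hA j hj).imp_right le_of_lt
      have hwoman : womanUtil B M t ≤ B t t := by
        refine sum_mul_le_of_subprob (fun j => hpos j t) (hcol t) (hnn t t).2 fun j => ?_
        rcases eq_or_ne j t with rfl | hj
        · exact Or.inr le_rfl
        · exact (hB j hj).imp_right le_of_lt
      refine ⟨⟨hman, hwoman⟩, fun s hs => ?_⟩
      have hone : M t t = 1 := by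
        rcases hunblocked t hman hwoman with h | h
        · exact eq_one_of_le_sum_mul_s5 (hpos t) (hrow t)
            ((hnn t s).1.trans_lt (hdiag t s hs).1) hA h
        · exact eq_one_of_le_sum_mul_s5 (p := fun j => M j t) (a := fun j => B j t)
            (fun j => hpos j t) (hcol t) ((hnn s t).2.trans_lt (hdiag t s hs).2) hB h
      exact ⟨eq_zero_of_eq_one_s5 (hpos t) (hrow t) hone hs.ne',
        eq_zero_of_eq_one_s5 (p := fun j => M j t) (fun j => hpos j t) (hcol t) hone hs.ne'⟩
  exact (key t).1

/-- The integral matching that pairs `σ t` with `τ t` for every `t`. -/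
def pairing {n : ℕ} (σ τ : Equiv.Perm (Fin n)) (m w : Fin n) : ℝ :=
  if σ.symm m = τ.symm w then 1 else 0

lemma manUtil_pairing {n : ℕ} (σ τ : Equiv.Perm (Fin n)) (U : Fin n → Fin n → ℝ) (t : Fin n) :
    manUtil U (pairing σ τ) (σ t) = U (σ t) (τ t) := by
  rw [manUtil, ← Equiv.sum_comp τ]
  simp [pairing]

lemma womanUtil_pairing {n : ℕ} (σ τ : Equiv.Perm (Fin n)) (V : Fin n → Fin n → ℝ) (t : Fin n) :
    womanUtil V (pairing σ τ) (τ t) = V (σ t) (τ t) := by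
  rw [womanUtil, ← Equiv.sum_comp σ]
  simp [pairing]

lemma isFracMatching_pairing {n : ℕ} (σ τ : Equiv.Perm (Fin n)) :
    IsFracMatching (pairing σ τ) := by
  refine ⟨fun m w => ?_, fun m => ?_, fun w => ?_⟩
  · unfold pairing
    split_ifs <;> norm_num
  · rw [← Equiv.sum_comp τ]
    simp [pairing]
  · rw [← Equiv.sum_comp σ]
    simp [pairing]

lemma isStable_pairing {n : ℕ} {U V : Fin n → Fin n → ℝ} {σ τ : Equiv.Perm (Fin n)}
    (h : ∀ t s, t < s → U (σ t) (τ t) > U (σ t) (τ s) ∧ V (σ t) (τ t) > V (σ s) (τ t)) :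
    IsStable U V (pairing σ τ) := by
  rintro ⟨m, w, hU, hV⟩
  obtain ⟨i, rfl⟩ := σ.surjective m
  obtain ⟨j, rfl⟩ := τ.surjective w
  rw [manUtil_pairing] at hU
  rw [womanUtil_pairing] at hV
  rcases lt_trichotomy i j with hij | rfl | hij
  · exact lt_asymm hU (h i j hij).1
  · exact lt_irrefl _ hU
  · exact lt_asymm hV (h j i hij).2

lemma manUtil_comp_perm {n : ℕ} (σ τ : Equiv.Perm (Fin n)) (U μ : Fin n → Fin n → ℝ)
    (t : Fin n) :
    manUtil (fun i j => U (σ i) (τ j)) (fun i j => μ (σ i) (τ j)) t = manUtil U μ (σ t) :=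
  Equiv.sum_comp τ fun w => μ (σ t) w * U (σ t) w

lemma womanUtil_comp_perm {n : ℕ} (σ τ : Equiv.Perm (Fin n)) (V μ : Fin n → Fin n → ℝ)
    (t : Fin n) :
    womanUtil (fun i j => V (σ i) (τ j)) (fun i j => μ (σ i) (τ j)) t = womanUtil V μ (τ t) :=
  Equiv.sum_comp σ fun m => μ m (τ t) * V m (τ t)

lemma IsFracMatching.comp_perm {n : ℕ} {μ : Fin n → Fin n → ℝ} (hμ : IsFracMatching μ)
    (σ τ : Equiv.Perm (Fin n)) : IsFracMatching fun i j => μ (σ i) (τ j) :=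
  ⟨fun i j => hμ.1 (σ i) (τ j), fun i => (Equiv.sum_comp τ (μ (σ i))).trans_le (hμ.2.1 (σ i)),
    fun j => (Equiv.sum_comp σ fun m => μ m (τ j)).trans_le (hμ.2.2 (τ j))⟩

/-- On a CMFP instance with unique stable fractional matching `μ*`,
no coalition of agents (men `Sum.inl m`, women `Sum.inr w`) can jointly
misreport so that every member is strictly better off, under any mechanism
producing stable fractional matchings. -/
theorem cmfp_coalition_proof {n : ℕ} (U V : Fin n → Fin n → ℝ)
    (hnn : Nonneg U V) (hsp : StrictPrefs U V) (hcmfp : CMFP U V)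
    (μstar : Fin n → Fin n → ℝ)
    (hμstar : IsFracMatching μstar ∧ IsStable U V μstar)
    (huniq : ∀ μ : Fin n → Fin n → ℝ, IsFracMatching μ → IsStable U V μ → μ = μstar)
    (S : Set (Fin n ⊕ Fin n)) (hS : S.Nonempty)
    (U' V' : Fin n → Fin n → ℝ)
    (hU' : ∀ m : Fin n, Sum.inl m ∉ S → ∀ w, U' m w = U m w)
    (hV' : ∀ w : Fin n, Sum.inr w ∉ S → ∀ m, V' m w = V m w)
    (hnn' : Nonneg U' V') (hsp' : StrictPrefs U' V')
    (μ' : Fin n → Fin n → ℝ) (hμ' : IsFracMatching μ') (hst' : IsStable U' V' μ') :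
    ∃ a ∈ S, match a with
      | Sum.inl m => ∑ w, μ' m w * U m w ≤ ∑ w, μstar m w * U m w
      | Sum.inr w => ∑ m, μ' m w * V m w ≤ ∑ m, μstar m w * V m w := by
  obtain ⟨σ, τ, hστ⟩ := hcmfp
  obtain rfl := huniq _ (isFracMatching_pairing σ τ) (isStable_pairing hστ)
  by_contra! hcon
  have hbetterM : ∀ t, Sum.inl (σ t) ∈ S → U (σ t) (τ t) < manUtil U μ' (σ t) := fun t ht => by
    have := hcon _ ht
    rw [← manUtil_pairing σ τ U t]
    exact not_le.1 this
  have hbetterW : ∀ t, Sum.inr (τ t) ∈ S → V (σ t) (τ t) < womanUtil V μ' (τ t) := fun t ht => by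
    have := hcon _ ht
    rw [← womanUtil_pairing σ τ V t]
    exact not_le.1 this
  have hworse := diagonal_unimprovable (A := fun i j => U (σ i) (τ j))
    (B := fun i j => V (σ i) (τ j)) (fun i j => hnn (σ i) (τ j)) hστ (hμ'.comp_perm σ τ) (by
      intro t hm hw
      simp only [manUtil_comp_perm, womanUtil_comp_perm] at hm hw ⊢
      have hUt := hU' (σ t) fun h => hm.not_gt (hbetterM t h)
      have hVt := hV' (τ t) fun h => hw.not_gt (hbetterW t h)
      by_contra! hblock
      refine hst' ⟨σ t, τ t, ?_, ?_⟩
      · simpa only [manUtil, hUt] using hblock.1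
      · simpa only [womanUtil, hVt] using hblock.2)
  simp only [manUtil_comp_perm, womanUtil_comp_perm] at hworse
  obtain ⟨m | w, ha⟩ := hS
  · obtain ⟨t, rfl⟩ := σ.surjective m
    exact (hworse t).1.not_gt (hbetterM t ha)
  · obtain ⟨t, rfl⟩ := τ.surjective w
    exact (hworse t).2.not_gt (hbetterW t ha)
end

section
/- There exists a matching instance with strict preferences, two stable integral matchings μ1 and μ2 of that instance, and a real number α ∈ (0,1), such that the fractional matching α·μ1 + (1−α)·μ2 is not stable. In other words, the set of stable fractional matchings of an instance with strict preferences need not be convex. -/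
open Finset

/-- The set of stable fractional matchings need not be convex:
there is an instance with strict preferences, two stable integral matchings,
and `α ∈ (0,1)` whose convex combination is not stable. -/
theorem stable_matchings_not_convex :
    ∃ (n : ℕ) (U V : Fin n → Fin n → ℝ), Nonneg U V ∧ StrictPrefs U V ∧
      ∃ (μ1 μ2 : Fin n → Fin n → ℝ) (α : ℝ),
        IsFracMatching μ1 ∧ Integral μ1 ∧ IsStable U V μ1 ∧
        IsFracMatching μ2 ∧ Integral μ2 ∧ IsStable U V μ2 ∧
        α ∈ Set.Ioo (0 : ℝ) 1 ∧
        ¬ IsStable U V (fun m w => α * μ1 m w + (1 - α) * μ2 m w) := by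
  refine ⟨3, ![![4, 3, 0], ![0, 4, 3], ![3, 0, 4]], ![![0, 3, 4], ![4, 0, 3], ![3, 4, 0]],
    ?_, ⟨?_, ?_⟩, ![![1, 0, 0], ![0, 1, 0], ![0, 0, 1]], ![![0, 0, 1], ![1, 0, 0], ![0, 1, 0]],
    1 / 2, ⟨?_, ?_, ?_⟩, ?_, ?_, ⟨?_, ?_, ?_⟩, ?_, ?_, ?_, ?_⟩
  · intro m w
    fin_cases m <;> fin_cases w <;> norm_num
  · intro m a b h
    fin_cases m <;> fin_cases a <;> fin_cases b <;> first | rfl | (norm_num at h)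
  · intro w a b h
    fin_cases w <;> fin_cases a <;> fin_cases b <;> first | rfl | (norm_num at h)
  · intro m w
    fin_cases m <;> fin_cases w <;> norm_num
  · intro m
    fin_cases m <;> norm_num [Fin.sum_univ_succ]
  · intro w
    fin_cases w <;> norm_num [Fin.sum_univ_succ]
  · intro m w
    fin_cases m <;> fin_cases w <;> norm_num
  · rintro ⟨m, w, hm, -⟩
    fin_cases m <;> fin_cases w <;> norm_num [manUtil, Fin.sum_univ_succ] at hm
  · intro m w
    fin_cases m <;> fin_cases w <;> norm_num
  · intro m
    fin_cases m <;> norm_num [Fin.sum_univ_succ]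
  · intro w
    fin_cases w <;> norm_num [Fin.sum_univ_succ]
  · intro m w
    fin_cases m <;> fin_cases w <;> norm_num
  · rintro ⟨m, w, hm, hw⟩
    fin_cases m <;> fin_cases w <;> norm_num [manUtil, Fin.sum_univ_succ] at hm <;>
      norm_num [womanUtil, Fin.sum_univ_succ] at hw
  · norm_num
  · exact not_not_intro ⟨0, 1, by norm_num [manUtil, Fin.sum_univ_succ],
      by norm_num [womanUtil, Fin.sum_univ_succ]⟩
end

section
/- There exists a matching instance with strict preferences that has exactly one stable integral matching but at least two distinct stable fractional matchings (in particular, a stable fractional matching that is not integral). -/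
open Finset

theorem vec_three_two {α : Type*} (a b c : α) : ![a, b, c] 2 = c := rfl

/-- The men's valuations in the example. -/
def exampleU : Fin 3 → Fin 3 → ℝ := ![![2, 1, 3], ![3, 1, 2], ![2, 1, 3]]

/-- The women's valuations in the example, indexed by man and then woman. -/
def exampleV : Fin 3 → Fin 3 → ℝ := ![![3, 1, 2], ![1, 3, 3], ![2, 2, 1]]

/-- The unique stable integral matching of the example. -/
def exampleIntegral : Fin 3 → Fin 3 → ℝ := ![![1, 0, 0], ![0, 0, 1], ![0, 1, 0]]

/-- A non-integral stable matching of the example. -/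
noncomputable def exampleFractional : Fin 3 → Fin 3 → ℝ :=
  ![![1 / 2, 0, 1 / 2], ![1 / 2, 0, 1 / 2], ![0, 1, 0]]

theorem nonneg_example : Nonneg exampleU exampleV := by
  intro m w
  fin_cases m <;> fin_cases w <;> norm_num [-Matrix.cons_val', vec_three_two, exampleU, exampleV]

theorem strictPrefs_example : StrictPrefs exampleU exampleV := by
  constructor <;> intro i a b h <;> fin_cases i <;> fin_cases a <;> fin_cases b <;>
    first
    | rfl
    | (exfalso; norm_num [-Matrix.cons_val', vec_three_two, exampleU, exampleV] at h)

theorem isFracMatching_exampleIntegral : IsFracMatching exampleIntegral := by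
  refine ⟨fun m w => ?_, fun m => ?_, fun w => ?_⟩
  · fin_cases m <;> fin_cases w <;> norm_num [-Matrix.cons_val', vec_three_two, exampleIntegral]
  · fin_cases m <;> norm_num [-Matrix.cons_val', vec_three_two, exampleIntegral, Fin.sum_univ_three]
  · fin_cases w <;> norm_num [-Matrix.cons_val', vec_three_two, exampleIntegral, Fin.sum_univ_three]

theorem integral_exampleIntegral : Integral exampleIntegral := by
  intro m w
  fin_cases m <;> fin_cases w <;> norm_num [-Matrix.cons_val', vec_three_two, exampleIntegral]

theorem isStable_exampleIntegral : IsStable exampleU exampleV exampleIntegral := by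
  rintro ⟨m, w, h₁, h₂⟩
  fin_cases m <;> fin_cases w <;> revert h₁ h₂ <;>
    norm_num [-Matrix.cons_val', vec_three_two, exampleU, exampleV, exampleIntegral,
      manUtil, womanUtil, Fin.sum_univ_three]

theorem isFracMatching_exampleFractional : IsFracMatching exampleFractional := by
  refine ⟨fun m w => ?_, fun m => ?_, fun w => ?_⟩
  · fin_cases m <;> fin_cases w <;> norm_num [-Matrix.cons_val', vec_three_two, exampleFractional]
  · fin_cases m <;> norm_num [-Matrix.cons_val', vec_three_two, exampleFractional, Fin.sum_univ_three]
  · fin_cases w <;> norm_num [-Matrix.cons_val', vec_three_two, exampleFractional, Fin.sum_univ_three]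

theorem isStable_exampleFractional : IsStable exampleU exampleV exampleFractional := by
  rintro ⟨m, w, h₁, h₂⟩
  fin_cases m <;> fin_cases w <;> revert h₁ h₂ <;>
    norm_num [-Matrix.cons_val', vec_three_two, exampleU, exampleV, exampleFractional,
      manUtil, womanUtil, Fin.sum_univ_three]

theorem not_integral_exampleFractional : ¬ Integral exampleFractional := by
  intro h
  have := h 0 0
  norm_num [-Matrix.cons_val', vec_three_two, exampleFractional] at this

/-- A 0/1 triple of sum at most one is zero or a unit vector. -/
theorem zero_one_triple_cases {a b c : ℝ} (ha : a = 0 ∨ a = 1) (hb : b = 0 ∨ b = 1)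
    (hc : c = 0 ∨ c = 1) (h : a + b + c ≤ 1) :
    (a = 0 ∧ b = 0 ∧ c = 0) ∨ (a = 1 ∧ b = 0 ∧ c = 0) ∨
      (a = 0 ∧ b = 1 ∧ c = 0) ∨ (a = 0 ∧ b = 0 ∧ c = 1) := by
  rcases ha with rfl | rfl <;> rcases hb with rfl | rfl <;> rcases hc with rfl | rfl <;>
    revert h <;> norm_num

theorem eq_exampleIntegral {μ : Fin 3 → Fin 3 → ℝ} (hμ : IsFracMatching μ)
    (hint : Integral μ) (hst : IsStable exampleU exampleV μ) : μ = exampleIntegral := by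
  obtain ⟨-, hrow, hcol⟩ := hμ
  have hs : ∀ m w, exampleU m w ≤ manUtil exampleU μ m ∨
      exampleV m w ≤ womanUtil exampleV μ w := by
    intro m w
    by_contra! h
    exact hst ⟨m, w, h⟩
  simp only [manUtil, womanUtil, Fin.sum_univ_three] at hs hrow hcol
  have c0 := hcol 0
  have c1 := hcol 1
  have c2 := hcol 2
  have s00 := hs 0 0
  have s01 := hs 0 1
  have s02 := hs 0 2
  have s10 := hs 1 0
  have s11 := hs 1 1
  have s12 := hs 1 2
  have s20 := hs 2 0
  have s21 := hs 2 1
  have s22 := hs 2 2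
  have rows := fun m => zero_one_triple_cases (hint m 0) (hint m 1) (hint m 2) (hrow m)
  clear hs hst hcol hrow hint
  suffices h : (μ 0 0 = 1 ∧ μ 0 1 = 0 ∧ μ 0 2 = 0) ∧ (μ 1 0 = 0 ∧ μ 1 1 = 0 ∧ μ 1 2 = 1) ∧
      (μ 2 0 = 0 ∧ μ 2 1 = 1 ∧ μ 2 2 = 0) by
    obtain ⟨⟨_, _, _⟩, ⟨_, _, _⟩, ⟨_, _, _⟩⟩ := h
    ext m w
    fin_cases m <;> fin_cases w <;> simpa [exampleIntegral]
  rcases rows 0 with ⟨h00, h01, h02⟩ | ⟨h00, h01, h02⟩ | ⟨h00, h01, h02⟩ | ⟨h00, h01, h02⟩ <;>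
  rcases rows 1 with ⟨h10, h11, h12⟩ | ⟨h10, h11, h12⟩ | ⟨h10, h11, h12⟩ | ⟨h10, h11, h12⟩ <;>
  rcases rows 2 with ⟨h20, h21, h22⟩ | ⟨h20, h21, h22⟩ | ⟨h20, h21, h22⟩ | ⟨h20, h21, h22⟩ <;>
  revert c0 c1 c2 s00 s01 s02 s10 s11 s12 s20 s21 s22 <;>
  norm_num [-Matrix.cons_val', vec_three_two, exampleU, exampleV,
    h00, h01, h02, h10, h11, h12, h20, h21, h22]

/-- There is an instance with strict preferences having exactly
one stable integral matching but at least two distinct stable fractional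
matchings (in particular, a stable fractional matching that is not integral). -/
theorem unique_integral_multiple_fractional :
    ∃ (n : ℕ) (U V : Fin n → Fin n → ℝ), Nonneg U V ∧ StrictPrefs U V ∧
      (∃! μ : Fin n → Fin n → ℝ, IsFracMatching μ ∧ Integral μ ∧ IsStable U V μ) ∧
      (∃ μ1 μ2 : Fin n → Fin n → ℝ,
        IsFracMatching μ1 ∧ IsStable U V μ1 ∧
        IsFracMatching μ2 ∧ IsStable U V μ2 ∧ μ1 ≠ μ2) ∧
      (∃ μ : Fin n → Fin n → ℝ, IsFracMatching μ ∧ IsStable U V μ ∧ ¬ Integral μ) := by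
  refine ⟨3, exampleU, exampleV, nonneg_example, strictPrefs_example,
    ⟨exampleIntegral, ⟨isFracMatching_exampleIntegral, integral_exampleIntegral,
      isStable_exampleIntegral⟩, fun μ h => eq_exampleIntegral h.1 h.2.1 h.2.2⟩,
    ⟨exampleIntegral, exampleFractional, isFracMatching_exampleIntegral,
      isStable_exampleIntegral, isFracMatching_exampleFractional,
      isStable_exampleFractional, fun h => ?_⟩,
    ⟨exampleFractional, isFracMatching_exampleFractional, isStable_exampleFractional,
      not_integral_exampleFractional⟩⟩
  exact not_integral_exampleFractional (h ▸ integral_exampleIntegral)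
end

section
/- There exists a matching instance with strict preferences, a positive integer k, integral matchings ν_1,…,ν_k of that instance each of which is NOT stable, and positive real weights x_1,…,x_k with x_1 + … + x_k = 1, such that the fractional matching x_1·ν_1 + … + x_k·ν_k IS stable. That is, there exist stable fractional matchings whose support consists solely of unstable integral matchings. -/
open Finset

/-- There exist stable fractional matchings whose support
consists solely of unstable integral matchings. -/
theorem stable_fractional_with_unstable_support :
    ∃ (n : ℕ) (U V : Fin n → Fin n → ℝ), Nonneg U V ∧ StrictPrefs U V ∧
      ∃ (k : ℕ), 0 < k ∧
        ∃ (ν : Fin k → Fin n → Fin n → ℝ) (x : Fin k → ℝ),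
          (∀ i, IsFracMatching (ν i) ∧ Integral (ν i) ∧ ¬ IsStable U V (ν i)) ∧
          (∀ i, 0 < x i) ∧ (∑ i, x i = 1) ∧
          IsFracMatching (fun m w => ∑ i, x i * ν i m w) ∧
          IsStable U V (fun m w => ∑ i, x i * ν i m w) := by
  refine ⟨3, fun m w => if w = m then 4 else if w = m + 1 then 1 else 0,
    fun m w => if w = m then 0 else if w = m + 1 then 1 else 4,
    ?_, ⟨?_, ?_⟩, 3, by norm_num, fun i m w => if m + w = i then 1 else 0, fun _ => 1 / 3,
    ?_, ?_, ?_, ⟨?_, ?_, ?_⟩, ?_⟩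
  · intro m w
    constructor <;> positivity
  · intro m a b h
    fin_cases m <;> fin_cases a <;> fin_cases b <;>
      first
      | rfl
      | (exfalso; revert h; simp +decide)
  · intro w a b h
    fin_cases w <;> fin_cases a <;> fin_cases b <;>
      first
      | rfl
      | (exfalso; revert h; simp +decide)
  · intro i
    refine ⟨⟨?_, ?_, ?_⟩, ?_, ?_⟩
    · intro m w
      positivity
    · intro m
      simp [← eq_sub_iff_add_eq']
    · intro w
      simp [← eq_sub_iff_add_eq]
    · intro m w
      by_cases h : m + w = i <;> simp [h]
    · rw [IsStable, not_not]
      refine ⟨2 * i + 2, 2 * i, ?_⟩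
      fin_cases i <;>
        simp +decide [Blocks, manUtil, womanUtil, Fin.sum_univ_three]
  · intro i
    norm_num
  · norm_num
  · intro m w
    positivity
  · intro m
    simp
  · intro w
    simp
  · rintro ⟨m, w, h⟩
    revert h
    fin_cases m <;> fin_cases w <;>
      simp +decide [Blocks, manUtil, womanUtil, Fin.sum_univ_three] <;> norm_num
end

section
/- Let I be a matching instance of size n with strict preferences that has no mutual-first-preference pair, and let σ be a permutation of Fin n defining a perfect integral matching (man m matched to woman σ(m)). Then for every man m, at least one of the following holds: man m envies some other man (i.e., U m (σ(m')) > U m (σ(m)) for some man m'), or his partner σ(m) envies some other woman (i.e., V(σ⁻¹(w'), σ(m)) > V(m, σ(m)) for some woman w'). In particular, at least one of the two envy-graphs under the matching is non-empty. -/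
open Finset

/-- In an instance with strict preferences and no MFP pair, under
any perfect integral matching (man `m` matched to woman `σ m`), every man
either envies some man or his partner envies some woman. -/
theorem no_mfp_envy_nonempty {n : ℕ} (U V : Fin n → Fin n → ℝ)
    (hnn : Nonneg U V) (hsp : StrictPrefs U V)
    (hnomfp : ¬ ∃ m w : Fin n, MFP U V m w)
    (σ : Equiv.Perm (Fin n)) :
    ∀ m : Fin n,
      (∃ m' : Fin n, U m (σ m') > U m (σ m)) ∨
      (∃ w' : Fin n, V (σ.symm w') (σ m) > V m (σ m)) := by
  intro m
  by_contra! h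
  obtain ⟨hU, hV⟩ := h
  refine hnomfp ⟨m, σ m, fun w' hw => ?_, fun m' hm => ?_⟩
  · have hle : U m w' ≤ U m (σ m) := by simpa using hU (σ.symm w')
    exact lt_of_le_of_ne hle ((hsp.1 m).ne hw)
  · have hle : V m' (σ m) ≤ V m (σ m) := by simpa using hV (σ m')
    exact lt_of_le_of_ne hle ((hsp.2 (σ m)).ne hm)
end

section
/- Let I be a matching instance of size n with strict preferences, let (m,w) be a mutual-first-preference pair of I, and let I' be the matching instance of size n−1 obtained from I by deleting man m and woman w (restricting U and V accordingly). If μ' is a stable fractional matching of I', then the fractional matching of I that assigns weight 1 to the pair (m,w), agrees with μ' on all pairs of remaining agents, and assigns weight 0 to all other pairs involving m or w, is a stable fractional matching of I. -/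
open Finset

/-- If `(m, w)` is an MFP pair of an instance of size `n + 1`
and `μ'` is a stable fractional matching of the subinstance obtained by
deleting `m` and `w`, then the matching `ν` that matches `m` with `w`
fully, agrees with `μ'` on the remaining agents (indexed via `Fin.succAbove`),
and is `0` on all other pairs involving `m` or `w`, is a stable fractional
matching of the original instance. -/
theorem mfp_extension_stable {n : ℕ} (U V : Fin (n + 1) → Fin (n + 1) → ℝ)
    (hnn : Nonneg U V) (hsp : StrictPrefs U V)
    (m w : Fin (n + 1)) (hmfp : MFP U V m w)
    (μ' : Fin n → Fin n → ℝ)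
    (hμ' : IsFracMatching μ')
    (hst' : IsStable (fun i j => U (m.succAbove i) (w.succAbove j))
                     (fun i j => V (m.succAbove i) (w.succAbove j)) μ')
    (ν : Fin (n + 1) → Fin (n + 1) → ℝ)
    (hν1 : ν m w = 1)
    (hν2 : ∀ w' : Fin (n + 1), w' ≠ w → ν m w' = 0)
    (hν3 : ∀ m' : Fin (n + 1), m' ≠ m → ν m' w = 0)
    (hν4 : ∀ (i j : Fin n), ν (m.succAbove i) (w.succAbove j) = μ' i j) :
    IsFracMatching ν ∧ IsStable U V ν := by
  have sum_man (A : Fin (n + 1) → Fin (n + 1) → ℝ) : ∑ j, ν m j * A m j = A m w := by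
    rw [Fin.sum_univ_succAbove _ w]
    simp [hν1, hν2 _ (Fin.succAbove_ne w _)]
  have sum_woman (A : Fin (n + 1) → Fin (n + 1) → ℝ) : ∑ i, ν i w * A i w = A m w := by
    rw [Fin.sum_univ_succAbove _ m]
    simp [hν1, hν3 _ (Fin.succAbove_ne m _)]
  have sum_man_rest (A : Fin (n + 1) → Fin (n + 1) → ℝ) (i : Fin n) :
      ∑ j, ν (m.succAbove i) j * A (m.succAbove i) j =
        ∑ j, μ' i j * A (m.succAbove i) (w.succAbove j) := by
    rw [Fin.sum_univ_succAbove _ w]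
    simp [hν4, hν3 _ (Fin.succAbove_ne m _)]
  have sum_woman_rest (A : Fin (n + 1) → Fin (n + 1) → ℝ) (j : Fin n) :
      ∑ i, ν i (w.succAbove j) * A i (w.succAbove j) =
        ∑ i, μ' i j * A (m.succAbove i) (w.succAbove j) := by
    rw [Fin.sum_univ_succAbove _ m]
    simp [hν4, hν2 _ (Fin.succAbove_ne w _)]
  obtain ⟨h_nonneg, h_row, h_col⟩ := hμ'
  refine ⟨⟨fun i j => ?_, fun i => ?_, fun j => ?_⟩, ?_⟩
  · rcases Fin.eq_self_or_eq_succAbove m i with rfl | ⟨i, rfl⟩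
    · by_cases hj : j = w
      · simp [hj, hν1]
      · simp [hν2 j hj]
    · rcases Fin.eq_self_or_eq_succAbove w j with rfl | ⟨j, rfl⟩
      · simp [hν3 _ (Fin.succAbove_ne m i)]
      · simpa [hν4] using h_nonneg i j
  · rcases Fin.eq_self_or_eq_succAbove m i with rfl | ⟨i, rfl⟩
    · simpa using (sum_man fun _ _ => 1).le
    · simpa using (sum_man_rest (fun _ _ => 1) i).le.trans (by simpa using h_row i)
  · rcases Fin.eq_self_or_eq_succAbove w j with rfl | ⟨j, rfl⟩
    · simpa using (sum_woman fun _ _ => 1).le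
    · simpa using (sum_woman_rest (fun _ _ => 1) j).le.trans (by simpa using h_col j)
  · rintro ⟨i, j, hU, hV⟩
    unfold manUtil at hU
    unfold womanUtil at hV
    rcases Fin.eq_self_or_eq_succAbove m i with rfl | ⟨i, rfl⟩
    · rw [sum_man] at hU
      by_cases hj : j = w
      · exact absurd hU (by simp [hj])
      · exact lt_asymm hU (hmfp.1 j hj)
    · rcases Fin.eq_self_or_eq_succAbove w j with rfl | ⟨j, rfl⟩
      · rw [sum_woman] at hV
        exact lt_asymm hV (hmfp.2 _ (Fin.succAbove_ne m i))
      · rw [sum_man_rest] at hU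
        rw [sum_woman_rest] at hV
        exact hst' ⟨i, j, hU, hV⟩
end
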